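/- arXiv:hep-th/9509094 — 3 statements merged into one kernel-verified Lean document; each statement's English description precedes it below -/
import Mathlib

section
/- For a second-order Lagrangian and every smooth function g(t,q₀,q₁,p⁰,p¹), the intertwining relation K₀·(g∘F₁) = (K₁·g)∘F₀ holds identically as functions of (t,q₀,q₁,q₂,q₃); here g∘F₁ is the function (t,q₀,q₁,q₂,p⁰) ↦ g(t,q₀,q₁,p⁰,p̂¹(q₀,q₁,q₂)) and (K₁·g)∘F₀ is the function (t,q₀,q₁,q₂,q₃) ↦ (K₁·g)(t,q₀,q₁,q₂,p̂⁰(q₀,q₁,q₂,q₃)). -/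
open scoped BigOperators

noncomputable section

/-- `Vec n` is `ℝⁿ`. -/
abbrev Vec (n : ℕ) := Fin n → ℝ

/-- The standard inner product on `ℝⁿ`. -/
def dot {n : ℕ} (u v : Vec n) : ℝ := ∑ a, u a * v a

variable {n : ℕ}

/-- Partial gradient `∂L/∂q₀` of a second-order Lagrangian `L(q₀,q₁,q₂)`,
identified with a vector of `ℝⁿ` via the standard inner product. -/
def g0 (L : Vec n × Vec n × Vec n → ℝ) (x : Vec n × Vec n × Vec n) : Vec n :=
  fun a => fderiv ℝ L x (Pi.single a 1, 0, 0)

/-- Partial gradient `∂L/∂q₁`. -/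
def g1 (L : Vec n × Vec n × Vec n → ℝ) (x : Vec n × Vec n × Vec n) : Vec n :=
  fun a => fderiv ℝ L x (0, Pi.single a 1, 0)

/-- Partial gradient `∂L/∂q₂`. -/
def g2 (L : Vec n × Vec n × Vec n → ℝ) (x : Vec n × Vec n × Vec n) : Vec n :=
  fun a => fderiv ℝ L x (0, 0, Pi.single a 1)

/-- The Ostrogradskii momentum `p̂¹ = ∂L/∂q₂`, a function of `(q₀,q₁,q₂)`. -/
def p1hat (L : Vec n × Vec n × Vec n → ℝ) (q0 q1 q2 : Vec n) : Vec n :=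
  g2 L (q0, q1, q2)

/-- The Ostrogradskii momentum `p̂⁰ = ∂L/∂q₁ − D_t p̂¹`,
a function of `(q₀,q₁,q₂,q₃)`. -/
def p0hat (L : Vec n × Vec n × Vec n → ℝ) (q0 q1 q2 q3 : Vec n) : Vec n :=
  fun a => g1 L (q0, q1, q2) a -
    fderiv ℝ (fun y : Vec n × Vec n × Vec n => p1hat L y.1 y.2.1 y.2.2 a)
      (q0, q1, q2) (q1, q2, q3)

/-- The Euler–Lagrange expression `[L] = ∂L/∂q₀ − D_t p̂⁰`,
a function of `(q₀,…,q₄)`. -/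
def EL (L : Vec n × Vec n × Vec n → ℝ) (q0 q1 q2 q3 q4 : Vec n) : Vec n :=
  fun a => g0 L (q0, q1, q2) a -
    fderiv ℝ (fun y : Vec n × Vec n × Vec n × Vec n =>
        p0hat L y.1 y.2.1 y.2.2.1 y.2.2.2 a)
      (q0, q1, q2, q3) (q1, q2, q3, q4)

/-- The intermediate evolution operator `K₁` acting on a function
`g(t,q₀,q₁,p⁰,p¹)` on the phase space `P₂`, producing a function of
`(t,q₀,q₁,q₂,p⁰)` on the intermediate space `P₁`:
`K₁·g = (∂g/∂t)∘F₁ + ((∂g/∂q₀)∘F₁)·q₁ + ((∂g/∂q₁)∘F₁)·q₂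
 + ((∂g/∂p⁰)∘F₁)·(∂L/∂q₀) + ((∂g/∂p¹)∘F₁)·(∂L/∂q₁ − p⁰)`. -/
def K1 (L : Vec n × Vec n × Vec n → ℝ)
    (g : ℝ × Vec n × Vec n × Vec n × Vec n → ℝ)
    (t : ℝ) (q0 q1 q2 p0 : Vec n) : ℝ :=
  fderiv ℝ g (t, q0, q1, p0, p1hat L q0 q1 q2)
    (1, q1, q2, g0 L (q0, q1, q2), g1 L (q0, q1, q2) - p0)

/-- The intermediate evolution operator `K₀` acting on a function
`h(t,q₀,q₁,q₂,p⁰)` on `P₁`, producing a function of `(t,q₀,q₁,q₂,q₃)`: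
`K₀·h = (∂h/∂t)∘F₀ + Σ_{i=0}^{2} ((∂h/∂q_i)∘F₀)·q_{i+1} + ((∂h/∂p⁰)∘F₀)·(∂L/∂q₀)`. -/
def K0 (L : Vec n × Vec n × Vec n → ℝ)
    (h : ℝ × Vec n × Vec n × Vec n × Vec n → ℝ)
    (t : ℝ) (q0 q1 q2 q3 : Vec n) : ℝ :=
  fderiv ℝ h (t, q0, q1, q2, p0hat L q0 q1 q2 q3)
    (1, q1, q2, q3, g0 L (q0, q1, q2))

/-- The pull-back `g∘F₁ : (t,q₀,q₁,q₂,p⁰) ↦ g(t,q₀,q₁,p⁰,p̂¹(q₀,q₁,q₂))`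
through the partial Legendre–Ostrogradskii map `F₁`. -/
def pullF1 (L : Vec n × Vec n × Vec n → ℝ)
    (g : ℝ × Vec n × Vec n × Vec n × Vec n → ℝ)
    (x : ℝ × Vec n × Vec n × Vec n × Vec n) : ℝ :=
  g (x.1, x.2.1, x.2.2.1, x.2.2.2.2, p1hat L x.2.1 x.2.2.1 x.2.2.2.1)

/-- The pull-back `g∘FL : (t,q₀,q₁,q₂,q₃) ↦ g(t,q₀,q₁,p̂⁰,p̂¹)`
through the total Legendre–Ostrogradskii map `FL`. -/
def pullFL (L : Vec n × Vec n × Vec n → ℝ)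
    (g : ℝ × Vec n × Vec n × Vec n × Vec n → ℝ)
    (x : ℝ × Vec n × Vec n × Vec n × Vec n) : ℝ :=
  g (x.1, x.2.1, x.2.2.1, p0hat L x.2.1 x.2.2.1 x.2.2.2.1 x.2.2.2.2,
     p1hat L x.2.1 x.2.2.1 x.2.2.2.1)

/-- The formal total time derivative of a function `f(t,q₀,q₁,q₂,q₃)`:
`D_t f = ∂f/∂t + Σ_{i=0}^{3} (∂f/∂q_i)·q_{i+1}`, a function of `(t,q₀,…,q₄)`. -/
def Dt (f : ℝ × Vec n × Vec n × Vec n × Vec n → ℝ)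
    (t : ℝ) (q0 q1 q2 q3 q4 : Vec n) : ℝ :=
  fderiv ℝ f (t, q0, q1, q2, q3) (1, q1, q2, q3, q4)

/-- The partial gradient `∂g/∂p⁰` of a function `g(t,q₀,q₁,p⁰,p¹)` on the
phase space `P₂`, as a vector of `ℝⁿ`. -/
def gradP0 (g : ℝ × Vec n × Vec n × Vec n × Vec n → ℝ)
    (x : ℝ × Vec n × Vec n × Vec n × Vec n) : Vec n :=
  fun a => fderiv ℝ g x (0, 0, 0, Pi.single a 1, 0)

theorem contDiff_g2 {L : Vec n × Vec n × Vec n → ℝ} (hL : ContDiff ℝ (⊤ : ℕ∞) L) :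
    ContDiff ℝ (⊤ : ℕ∞) (g2 L) :=
  contDiff_pi.2 fun _ => (hL.fderiv_right (m := (⊤ : ℕ∞)) le_rfl).clm_apply contDiff_const

/-- `∂L/∂q₁ − p̂⁰` is the total time derivative of `p̂¹`. -/
theorem g1_sub_p0hat {L : Vec n × Vec n × Vec n → ℝ} (hL : ContDiff ℝ (⊤ : ℕ∞) L)
    (q0 q1 q2 q3 : Vec n) :
    g1 L (q0, q1, q2) - p0hat L q0 q1 q2 q3 =
      fderiv ℝ (g2 L) (q0, q1, q2) (q1, q2, q3) := by
  have hd : DifferentiableAt ℝ (g2 L) (q0, q1, q2) :=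
    (contDiff_g2 hL).differentiable (by simp) _
  ext a
  have ha : fderiv ℝ (fun y : Vec n × Vec n × Vec n => p1hat L y.1 y.2.1 y.2.2 a)
      (q0, q1, q2) (q1, q2, q3) = fderiv ℝ (g2 L) (q0, q1, q2) (q1, q2, q3) a :=
    congrArg (fun T => T (q1, q2, q3)) (hasFDerivAt_pi'.1 hd.hasFDerivAt a).fderiv
  simp only [Pi.sub_apply, p0hat, ha, sub_sub_cancel]

/-- intertwining of the intermediate evolution operators.
For a second-order Lagrangian `L(q₀,q₁,q₂)` and every smooth function
`g(t,q₀,q₁,p⁰,p¹)` on the phase space `P₂`, one has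
`K₀·(g∘F₁) = (K₁·g)∘F₀` identically as functions of `(t,q₀,q₁,q₂,q₃)`. -/
theorem K0_pullF1_eq_K1_pullF0
    (n : ℕ) (hn : 1 ≤ n)
    (L : Vec n × Vec n × Vec n → ℝ) (hL : ContDiff ℝ (⊤ : ℕ∞) L)
    (g : ℝ × Vec n × Vec n × Vec n × Vec n → ℝ) (hg : ContDiff ℝ (⊤ : ℕ∞) g) :
    ∀ (t : ℝ) (q0 q1 q2 q3 : Vec n),
      K0 L (pullF1 L g) t q0 q1 q2 q3 =
        K1 L g t q0 q1 q2 (p0hat L q0 q1 q2 q3) := by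
  intro t q0 q1 q2 q3
  have hp : HasFDerivAt (g2 L) (fderiv ℝ (g2 L) (q0, q1, q2)) (q0, q1, q2) :=
    ((contDiff_g2 hL).differentiable (by simp) _).hasFDerivAt
  set x : ℝ × Vec n × Vec n × Vec n × Vec n := (t, q0, q1, q2, p0hat L q0 q1 q2 q3)
  have h1 := hasFDerivAt_fst (𝕜 := ℝ) (p := x)
  have hs := hasFDerivAt_snd (𝕜 := ℝ) (p := x)
  have h2 := hs.fst
  have h3 := hs.snd.fst
  have h4 := hs.snd.snd.fst
  have h5 := hs.snd.snd.snd
  have h6 := HasFDerivAt.comp x hp (h2.prodMk (h3.prodMk h4))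
  have hG := (hg.differentiable (by simp)
    (t, q0, q1, p0hat L q0 q1 q2 q3, p1hat L q0 q1 q2)).hasFDerivAt
  have key := HasFDerivAt.comp x hG (h1.prodMk (h2.prodMk (h3.prodMk (h5.prodMk h6))))
  rw [K1, g1_sub_p0hat hL]
  exact congrArg (fun T => T (1, q1, q2, q3, g0 L (q0, q1, q2))) key.fderiv

end
end

section
/- For a second-order Lagrangian and every smooth function g(t,q₀,q₁,p⁰,p¹), the identity (K₁·g)∘F₀ = ⟨[L], (∂g/∂p⁰)∘FL⟩ + D_t(g∘FL) holds identically as functions of (t,q₀,…,q₄) (the operator K_E = F₀*∘K₁ written through the Euler–Lagrange expression). Consequently, if a smooth function G_H(t,q₀,q₁,p⁰,p¹) satisfies (K₁·G_H)∘F₀ = 0 identically, then δq = (∂G_H/∂p⁰)∘FL is a Noether transformation with conserved quantity G_H∘FL, i.e. ⟨[L], δq⟩ + D_t(G_H∘FL) = 0 identically. -/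
open scoped BigOperators

noncomputable section

variable {n : ℕ}

theorem contDiff_fderiv_comp_apply {E F : Type*} [NormedAddCommGroup E] [NormedSpace ℝ E]
    [NormedAddCommGroup F] [NormedSpace ℝ F] {f : E → ℝ} {u v : F → E}
    (hf : ContDiff ℝ (⊤ : ℕ∞) f) (hu : ContDiff ℝ (⊤ : ℕ∞) u) (hv : ContDiff ℝ (⊤ : ℕ∞) v) :
    ContDiff ℝ (⊤ : ℕ∞) fun y => fderiv ℝ f (u y) (v y) :=
  ((hf.fderiv_right (by simp)).comp hu).clm_apply hv

theorem contDiff_p1hat {L : Vec n × Vec n × Vec n → ℝ} (hL : ContDiff ℝ (⊤ : ℕ∞) L) (a : Fin n) :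
    ContDiff ℝ (⊤ : ℕ∞) fun y : Vec n × Vec n × Vec n => p1hat L y.1 y.2.1 y.2.2 a :=
  contDiff_fderiv_comp_apply hL contDiff_id contDiff_const

theorem contDiff_p0hat {L : Vec n × Vec n × Vec n → ℝ} (hL : ContDiff ℝ (⊤ : ℕ∞) L) (a : Fin n) :
    ContDiff ℝ (⊤ : ℕ∞) fun y : Vec n × Vec n × Vec n × Vec n =>
      p0hat L y.1 y.2.1 y.2.2.1 y.2.2.2 a :=
  (contDiff_fderiv_comp_apply hL (u := fun y : Vec n × Vec n × Vec n × Vec n =>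
      (y.1, y.2.1, y.2.2.1)) (by fun_prop) contDiff_const).sub
    (contDiff_fderiv_comp_apply (contDiff_p1hat hL a)
      (u := fun y : Vec n × Vec n × Vec n × Vec n => (y.1, y.2.1, y.2.2.1))
      (v := fun y => (y.2.1, y.2.2.1, y.2.2.2)) (by fun_prop) (by fun_prop))

/-- By the definition of `p̂⁰`, `D_t p̂¹ = ∂L/∂q₁ − p̂⁰`. -/
theorem hasFDerivAt_p1hat {L : Vec n × Vec n × Vec n → ℝ} (hL : ContDiff ℝ (⊤ : ℕ∞) L)
    (q0 q1 q2 q3 : Vec n) :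
    ∃ A : Vec n × Vec n × Vec n →L[ℝ] Vec n,
      HasFDerivAt (fun y : Vec n × Vec n × Vec n => p1hat L y.1 y.2.1 y.2.2) A (q0, q1, q2) ∧
        A (q1, q2, q3) = g1 L (q0, q1, q2) - p0hat L q0 q1 q2 q3 := by
  refine ⟨_, hasFDerivAt_pi.2 fun a =>
    ((contDiff_p1hat hL a).differentiable (by simp) (q0, q1, q2)).hasFDerivAt, ?_⟩
  ext a
  simp [p0hat]

/-- By the definition of `[L]`, `D_t p̂⁰ = ∂L/∂q₀ − [L]`. -/
theorem hasFDerivAt_p0hat {L : Vec n × Vec n × Vec n → ℝ} (hL : ContDiff ℝ (⊤ : ℕ∞) L)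
    (q0 q1 q2 q3 q4 : Vec n) :
    ∃ B : Vec n × Vec n × Vec n × Vec n →L[ℝ] Vec n,
      HasFDerivAt (fun y : Vec n × Vec n × Vec n × Vec n => p0hat L y.1 y.2.1 y.2.2.1 y.2.2.2) B
          (q0, q1, q2, q3) ∧
        B (q1, q2, q3, q4) = g0 L (q0, q1, q2) - EL L q0 q1 q2 q3 q4 := by
  refine ⟨_, hasFDerivAt_pi.2 fun a =>
    ((contDiff_p0hat hL a).differentiable (by simp) (q0, q1, q2, q3)).hasFDerivAt, ?_⟩
  ext a
  simp [EL]

theorem Dt_pullFL {L : Vec n × Vec n × Vec n → ℝ} (hL : ContDiff ℝ (⊤ : ℕ∞) L)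
    {g : ℝ × Vec n × Vec n × Vec n × Vec n → ℝ} (hg : Differentiable ℝ g)
    (t : ℝ) (q0 q1 q2 q3 q4 : Vec n) :
    Dt (pullFL L g) t q0 q1 q2 q3 q4 =
      fderiv ℝ g (t, q0, q1, p0hat L q0 q1 q2 q3, p1hat L q0 q1 q2)
        (1, q1, q2, g0 L (q0, q1, q2) - EL L q0 q1 q2 q3 q4,
          g1 L (q0, q1, q2) - p0hat L q0 q1 q2 q3) := by
  obtain ⟨A, hA, hAv⟩ := hasFDerivAt_p1hat hL q0 q1 q2 q3
  obtain ⟨B, hB, hBv⟩ := hasFDerivAt_p0hat hL q0 q1 q2 q3 q4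
  let x : ℝ × Vec n × Vec n × Vec n × Vec n := (t, q0, q1, q2, q3)
  have ht : HasFDerivAt (𝕜 := ℝ) (fun y : ℝ × Vec n × Vec n × Vec n × Vec n => y.1) _ x :=
    hasFDerivAt_fst
  have hq : HasFDerivAt (𝕜 := ℝ) (fun y : ℝ × Vec n × Vec n × Vec n × Vec n => y.2) _ x :=
    hasFDerivAt_snd
  have h0 := hq.fst
  have h1 := hq.snd.fst
  have h2 := hq.snd.snd.fst
  have hp1 := HasFDerivAt.comp x (show HasFDerivAt _ A (x.2.1, x.2.2.1, x.2.2.2.1) from hA)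
    (h0.prodMk (h1.prodMk h2))
  have hp0 := HasFDerivAt.comp x (show HasFDerivAt _ B x.2 from hB) hq
  have h := HasFDerivAt.comp x (hg _).hasFDerivAt
    (ht.prodMk (h0.prodMk (h1.prodMk (hp0.prodMk hp1))))
  have hv := congrArg (fun D => D (1, q1, q2, q3, q4)) h.fderiv
  rw [← hAv, ← hBv]
  exact hv

theorem dot_gradP0 (g : ℝ × Vec n × Vec n × Vec n × Vec n → ℝ) (v : Vec n)
    (x : ℝ × Vec n × Vec n × Vec n × Vec n) :
    dot v (gradP0 g x) = fderiv ℝ g x (0, 0, 0, v, 0) := by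
  let ι : Vec n →L[ℝ] ℝ × Vec n × Vec n × Vec n × Vec n :=
    (0 : Vec n →L[ℝ] ℝ).prod ((0 : Vec n →L[ℝ] Vec n).prod
      ((0 : Vec n →L[ℝ] Vec n).prod (.inl ℝ (Vec n) (Vec n))))
  have h := ((fderiv ℝ g x).comp ι).toLinearMap.pi_apply_eq_sum_univ v
  refine (Finset.sum_congr rfl fun a _ => ?_).trans h.symm
  have he : (fun j => if a = j then 1 else 0 : Vec n) = Pi.single a 1 := by
    ext j
    simp [Pi.single_apply, eq_comm]
  rw [he]
  rfl

/-- the operator `K_E = F₀*∘K₁` through the Euler–Lagrange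
expression.  For a second-order Lagrangian and every smooth function
`g(t,q₀,q₁,p⁰,p¹)`, one has
`(K₁·g)∘F₀ = ⟨[L], (∂g/∂p⁰)∘FL⟩ + D_t(g∘FL)` identically; consequently, if
`(K₁·G_H)∘F₀ = 0` identically then `δq = (∂G_H/∂p⁰)∘FL` is a Noether
transformation with conserved quantity `G_H∘FL`. -/
theorem K1_pullback_eq_EL_pairing_and_noether
    (n : ℕ) (hn : 1 ≤ n)
    (L : Vec n × Vec n × Vec n → ℝ) (hL : ContDiff ℝ (⊤ : ℕ∞) L)
    (g : ℝ × Vec n × Vec n × Vec n × Vec n → ℝ) (hg : ContDiff ℝ (⊤ : ℕ∞) g) :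
    (∀ (t : ℝ) (q0 q1 q2 q3 q4 : Vec n),
      K1 L g t q0 q1 q2 (p0hat L q0 q1 q2 q3) =
        dot (EL L q0 q1 q2 q3 q4)
            (gradP0 g (t, q0, q1, p0hat L q0 q1 q2 q3, p1hat L q0 q1 q2)) +
          Dt (pullFL L g) t q0 q1 q2 q3 q4) ∧
    ((∀ (t : ℝ) (q0 q1 q2 q3 : Vec n),
        K1 L g t q0 q1 q2 (p0hat L q0 q1 q2 q3) = 0) →
      ∀ (t : ℝ) (q0 q1 q2 q3 q4 : Vec n),
        dot (EL L q0 q1 q2 q3 q4)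
            (gradP0 g (t, q0, q1, p0hat L q0 q1 q2 q3, p1hat L q0 q1 q2)) +
          Dt (pullFL L g) t q0 q1 q2 q3 q4 = 0) := by
  have key : ∀ (t : ℝ) (q0 q1 q2 q3 q4 : Vec n),
      K1 L g t q0 q1 q2 (p0hat L q0 q1 q2 q3) =
        dot (EL L q0 q1 q2 q3 q4)
            (gradP0 g (t, q0, q1, p0hat L q0 q1 q2 q3, p1hat L q0 q1 q2)) +
          Dt (pullFL L g) t q0 q1 q2 q3 q4 := by
    intro t q0 q1 q2 q3 q4
    rw [dot_gradP0, Dt_pullFL hL (hg.differentiable (by simp)), ← map_add, K1]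
    simp
  exact ⟨key, fun h t q0 q1 q2 q3 q4 => (key t q0 q1 q2 q3 q4).symm.trans (h t q0 q1 q2 q3)⟩

end
end

section
/- For a second-order Lagrangian, let φ and χ be smooth real functions of (q₀,q₁,p¹) (independent of p⁰) such that φ(q₀,q₁,p̂¹(q₀,q₁,q₂)) = 0 and χ(q₀,q₁,p̂¹(q₀,q₁,q₂)) = 0 for all (q₀,q₁,q₂) (primary Hamiltonian constraints), and set γ_φ(q₀,q₁,q₂) = (∂φ/∂p¹)(q₀,q₁,p̂¹) ∈ ℝⁿ and similarly γ_χ. Then: (i) W γ_φ = 0 and W γ_χ = 0 pointwise; (ii) the function ⟨[L], γ_φ⟩ of (q₀,…,q₄) does not depend on q₄; and (iii) the directional derivative of ⟨[L], γ_φ⟩ with respect to q₃ in the direction γ_χ equals −{φ,χ}∘FL, i.e. −{φ,χ}(q₀,q₁,p̂⁰,p̂¹), identically in (q₀,q₁,q₂,q₃). -/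
open scoped BigOperators

noncomputable section

variable {n : ℕ}

/-- The Hessian `W = ∂²L/∂q₂∂q₂` of a second-order Lagrangian, as an operator
`ℝⁿ → ℝⁿ` (a function of `(q₀,q₁,q₂)`). -/
def hessOp (L : Vec n × Vec n × Vec n → ℝ) (q0 q1 q2 : Vec n) (v : Vec n) : Vec n :=
  fun a => fderiv ℝ (fun q2' => g2 L (q0, q1, q2') a) q2 v

/-- Canonical Poisson bracket on the phase space `(q₀,q₁,p⁰,p¹) ∈ (ℝⁿ)⁴`,
with the standard inner product. -/
def PB (f h : Vec n × Vec n × Vec n × Vec n → ℝ)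
    (z : Vec n × Vec n × Vec n × Vec n) : ℝ :=
  dot (fun a => fderiv ℝ f z (Pi.single a 1, 0, 0, 0))
      (fun a => fderiv ℝ h z (0, 0, Pi.single a 1, 0)) +
  dot (fun a => fderiv ℝ f z (0, Pi.single a 1, 0, 0))
      (fun a => fderiv ℝ h z (0, 0, 0, Pi.single a 1)) -
  dot (fun a => fderiv ℝ f z (0, 0, Pi.single a 1, 0))
      (fun a => fderiv ℝ h z (Pi.single a 1, 0, 0, 0)) -
  dot (fun a => fderiv ℝ f z (0, 0, 0, Pi.single a 1))
      (fun a => fderiv ℝ h z (0, Pi.single a 1, 0, 0))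

/-- The kernel vector field `γ_φ(q₀,q₁,q₂) = (∂φ/∂p¹)(q₀,q₁,p̂¹)` associated
with a primary Hamiltonian constraint `φ(q₀,q₁,p¹)`. -/
def gammaOf (L : Vec n × Vec n × Vec n → ℝ) (φ : Vec n × Vec n × Vec n → ℝ)
    (q0 q1 q2 : Vec n) : Vec n :=
  fun a => fderiv ℝ φ (q0, q1, p1hat L q0 q1 q2) (0, 0, Pi.single a 1)

section KernelFields

lemma dot_symm (u v : Vec n) : dot u v = dot v u := by
  simp only [dot, mul_comm]

lemma dot_clm_single (ℓ : Vec n →L[ℝ] ℝ) (v : Vec n) :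
    dot (fun a => ℓ (Pi.single a 1)) v = ℓ v := by
  conv_rhs => rw [pi_eq_sum_univ' v, map_sum]
  simp [dot, mul_comm, Pi.single]

lemma dot_clm_fst (ℓ : Vec n × Vec n × Vec n →L[ℝ] ℝ) (v : Vec n) :
    dot (fun a => ℓ (Pi.single a 1, 0, 0)) v = ℓ (v, 0, 0) :=
  dot_clm_single (ℓ ∘L .inl ℝ _ _) v

lemma dot_clm_snd (ℓ : Vec n × Vec n × Vec n →L[ℝ] ℝ) (v : Vec n) :
    dot (fun a => ℓ (0, Pi.single a 1, 0)) v = ℓ (0, v, 0) :=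
  dot_clm_single (ℓ ∘L .inr ℝ _ _ ∘L .inl ℝ _ _) v

lemma dot_clm_trd (ℓ : Vec n × Vec n × Vec n →L[ℝ] ℝ) (v : Vec n) :
    dot (fun a => ℓ (0, 0, Pi.single a 1)) v = ℓ (0, 0, v) :=
  dot_clm_single (ℓ ∘L .inr ℝ _ _ ∘L .inr ℝ _ _) v

section IteratedDerivatives

variable {E X : Type*} [NormedAddCommGroup E] [NormedSpace ℝ E] [NormedAddCommGroup X]
  [NormedSpace ℝ X] {f : X → ℝ}

lemma hasFDerivAt_fderiv (hf : ContDiff ℝ (⊤ : ℕ∞) f) (x : X) :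
    HasFDerivAt (fderiv ℝ f) (fderiv ℝ (fderiv ℝ f) x) x :=
  (((hf.fderiv_right (m := 1) (by norm_cast)).differentiable (by norm_num)) x).hasFDerivAt

lemma hasFDerivAt_fderiv_fderiv (hf : ContDiff ℝ (⊤ : ℕ∞) f) (x : X) :
    HasFDerivAt (fderiv ℝ (fderiv ℝ f)) (fderiv ℝ (fderiv ℝ (fderiv ℝ f)) x) x :=
  ((((hf.fderiv_right (m := 2) (by norm_cast)).fderiv_right (m := 1)
    (by norm_num)).differentiable (by norm_num)) x).hasFDerivAt

lemma fderiv_fderiv_symm (hf : ContDiff ℝ (⊤ : ℕ∞) f) (x u v : X) :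
    fderiv ℝ (fderiv ℝ f) x u v = fderiv ℝ (fderiv ℝ f) x v u :=
  ((hf.of_le (m := 2) (by norm_cast)).contDiffAt.isSymmSndFDerivAt (by simp)).eq u v

lemma fderiv_fderiv_fderiv_symm (hf : ContDiff ℝ (⊤ : ℕ∞) f) (x u v : X) :
    fderiv ℝ (fderiv ℝ (fderiv ℝ f)) x u v = fderiv ℝ (fderiv ℝ (fderiv ℝ f)) x v u :=
  ((hf.fderiv_right (m := 2) (by norm_cast)).contDiffAt.isSymmSndFDerivAt (by simp)).eq u v

lemma hasFDerivAt_fderiv_apply (hf : ContDiff ℝ (⊤ : ℕ∞) f) (x v : X) :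
    HasFDerivAt (fun y => fderiv ℝ f y v) ((fderiv ℝ (fderiv ℝ f) x).flip v) x :=
  ((hasFDerivAt_fderiv hf x).clm_apply (hasFDerivAt_const v x)).congr_fderiv (by simp)

lemma fderiv_fderiv_comp_sub (hf : ContDiff ℝ (⊤ : ℕ∞) f) (π σ : E →L[ℝ] X) (u v : X) (y k : E) :
    fderiv ℝ (fun y => fderiv ℝ f (π y) u - fderiv ℝ (fderiv ℝ f) (π y) (σ y) v) y k =
      fderiv ℝ (fderiv ℝ f) (π y) (π k) u -
      (fderiv ℝ (fderiv ℝ (fderiv ℝ f)) (π y) (π k) (σ y) v +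
        fderiv ℝ (fderiv ℝ f) (π y) (σ k) v) := by
  have h1 := (hasFDerivAt_fderiv_apply hf (π y) u).comp y π.hasFDerivAt
  have hT : HasFDerivAt (fun y => fderiv ℝ (fderiv ℝ f) (π y))
      (fderiv ℝ (fderiv ℝ (fderiv ℝ f)) (π y) ∘L π) y :=
    HasFDerivAt.comp (G := X →L[ℝ] X →L[ℝ] ℝ) y (hasFDerivAt_fderiv_fderiv hf (π y)) π.hasFDerivAt
  have h2 := hT.clm_apply (σ.hasFDerivAt (x := y))
  have h := HasFDerivAt.fun_sub h1 (h2.clm_apply (hasFDerivAt_const v y))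
  simp only [Function.comp_apply] at h
  rw [h.fderiv]
  simp [add_comm]

lemma fderiv_quadratic_comp_affine (c : ℝ) (A₁ A₂ : X →L[ℝ] ℝ) (T : X →L[ℝ] X →L[ℝ] X →L[ℝ] ℝ) (v b d : X)
    (ι κ : E →L[ℝ] X) (y w : E) :
    fderiv ℝ (fun y => c - A₁ (b + ι y) + T (b + ι y) (b + ι y) v + A₂ (d + κ y)) y w =
      - A₁ (ι w) + (T (ι w) (b + ι y) v + T (b + ι y) (ι w) v) + A₂ (κ w) := by
  have hξ : HasFDerivAt (fun y => b + ι y) ι y := ι.hasFDerivAt.const_add b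
  have hη : HasFDerivAt (fun y => d + κ y) κ y := κ.hasFDerivAt.const_add d
  have h1 := A₁.hasFDerivAt.comp y hξ
  have hT : HasFDerivAt (fun y => T (b + ι y)) (T ∘L ι) y :=
    HasFDerivAt.comp (G := X →L[ℝ] X →L[ℝ] ℝ) y
      (by apply ContinuousLinearMap.hasFDerivAt) hξ
  have h2 := (hT.clm_apply hξ).clm_apply (hasFDerivAt_const v y)
  have h3 := A₂.hasFDerivAt.comp y hη
  have h := (((hasFDerivAt_const c y).fun_sub h1).fun_add h2).fun_add h3
  simp only [Function.comp_apply] at h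
  rw [h.fderiv]
  simp [add_comm]

end IteratedDerivatives

variable {L φ χ : Vec n × Vec n × Vec n → ℝ}

lemma p0hat_apply (hL : ContDiff ℝ (⊤ : ℕ∞) L) (q0 q1 q2 q3 : Vec n) (a : Fin n) :
    p0hat L q0 q1 q2 q3 a = fderiv ℝ L (q0, q1, q2) (0, Pi.single a 1, 0) -
      fderiv ℝ (fderiv ℝ L) (q0, q1, q2) (q1, q2, q3) (0, 0, Pi.single a 1) := by
  have h := (hasFDerivAt_fderiv_apply hL (q0, q1, q2) (0, 0, Pi.single a 1)).fderiv
  simp only [p0hat, p1hat, g1, g2, Prod.mk.eta]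
  rw [h, ContinuousLinearMap.flip_apply]

lemma fderiv_p0hat_total (hL : ContDiff ℝ (⊤ : ℕ∞) L) (q0 q1 q2 q3 q4 : Vec n) (a : Fin n) :
    fderiv ℝ (fun y : Vec n × Vec n × Vec n × Vec n => p0hat L y.1 y.2.1 y.2.2.1 y.2.2.2 a)
        (q0, q1, q2, q3) (q1, q2, q3, q4) =
      fderiv ℝ (fderiv ℝ L) (q0, q1, q2) (q1, q2, q3) (0, Pi.single a 1, 0) -
      (fderiv ℝ (fderiv ℝ (fderiv ℝ L)) (q0, q1, q2) (q1, q2, q3) (q1, q2, q3)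
          (0, 0, Pi.single a 1) +
        fderiv ℝ (fderiv ℝ L) (q0, q1, q2) (q2, q3, q4) (0, 0, Pi.single a 1)) := by
  let π : Vec n × Vec n × Vec n × Vec n →L[ℝ] Vec n × Vec n × Vec n :=
    (ContinuousLinearMap.fst ℝ _ _).prod
      ((ContinuousLinearMap.fst ℝ _ _ ∘L .snd ℝ _ _).prod
        (ContinuousLinearMap.fst ℝ _ _ ∘L .snd ℝ _ _ ∘L .snd ℝ _ _))
  let σ : Vec n × Vec n × Vec n × Vec n →L[ℝ] Vec n × Vec n × Vec n := .snd ℝ _ _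
  have hp : (fun y : Vec n × Vec n × Vec n × Vec n => p0hat L y.1 y.2.1 y.2.2.1 y.2.2.2 a) =
      fun y => fderiv ℝ L (π y) (0, Pi.single a 1, 0) -
        fderiv ℝ (fderiv ℝ L) (π y) (σ y) (0, 0, Pi.single a 1) :=
    funext fun y => p0hat_apply hL _ _ _ _ a
  rw [hp, fderiv_fderiv_comp_sub hL]
  simp [π, σ]

lemma dot_EL (hL : ContDiff ℝ (⊤ : ℕ∞) L) (q0 q1 q2 q3 q4 v : Vec n) :
    dot (EL L q0 q1 q2 q3 q4) v =
      fderiv ℝ L (q0, q1, q2) (v, 0, 0)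
      - fderiv ℝ (fderiv ℝ L) (q0, q1, q2) (q1, q2, q3) (0, v, 0)
      + fderiv ℝ (fderiv ℝ (fderiv ℝ L)) (q0, q1, q2) (q1, q2, q3) (q1, q2, q3) (0, 0, v)
      + fderiv ℝ (fderiv ℝ L) (q0, q1, q2) (q2, q3, q4) (0, 0, v) := by
  rw [← dot_clm_fst, ← dot_clm_snd, ← dot_clm_trd, ← dot_clm_trd]
  simp only [dot, EL, g0, fderiv_p0hat_total hL]
  rw [← Finset.sum_sub_distrib, ← Finset.sum_add_distrib, ← Finset.sum_add_distrib]
  exact Finset.sum_congr rfl fun a _ => by ring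

lemma hasFDerivAt_p1hat_s10 (hL : ContDiff ℝ (⊤ : ℕ∞) L) (x : Vec n × Vec n × Vec n) :
    HasFDerivAt (fun y : Vec n × Vec n × Vec n => p1hat L y.1 y.2.1 y.2.2)
      (ContinuousLinearMap.pi fun a => (fderiv ℝ (fderiv ℝ L) x).flip (0, 0, Pi.single a 1)) x :=
  hasFDerivAt_pi.2 fun a => hasFDerivAt_fderiv_apply hL x (0, 0, Pi.single a 1)

lemma fderiv_constraint (hL : ContDiff ℝ (⊤ : ℕ∞) L) (hφ : ContDiff ℝ (⊤ : ℕ∞) φ)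
    (hφ0 : ∀ q0 q1 q2 : Vec n, φ (q0, q1, p1hat L q0 q1 q2) = 0) (q0 q1 q2 h0 h1 h2 : Vec n) :
    fderiv ℝ φ (q0, q1, p1hat L q0 q1 q2) (h0, h1, 0) +
      fderiv ℝ (fderiv ℝ L) (q0, q1, q2) (h0, h1, h2) (0, 0, gammaOf L φ q0 q1 q2) = 0 := by
  have hP := (hasFDerivAt_fst (𝕜 := ℝ) (p := (q0, q1, q2))).prodMk
    ((hasFDerivAt_snd (𝕜 := ℝ) (p := (q0, q1, q2))).fst.prodMk (hasFDerivAt_p1hat_s10 hL (q0, q1, q2)))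
  have hc := (hφ.differentiable (by simp) (q0, q1, p1hat L q0 q1 q2)).hasFDerivAt.comp
    (q0, q1, q2) hP
  have h0' : (φ ∘ fun y : Vec n × Vec n × Vec n => (y.1, y.2.1, p1hat L y.1 y.2.1 y.2.2)) =
      fun _ => 0 := funext fun y => hφ0 _ _ _
  rw [h0'] at hc
  have he := congrArg (· (h0, h1, h2)) (hc.unique (hasFDerivAt_const 0 _))
  rw [← dot_clm_trd, dot_symm]
  unfold gammaOf
  rw [dot_clm_trd, ← map_add]
  simpa using he

lemma hess_gammaOf (hL : ContDiff ℝ (⊤ : ℕ∞) L) (hφ : ContDiff ℝ (⊤ : ℕ∞) φ)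
    (hφ0 : ∀ q0 q1 q2 : Vec n, φ (q0, q1, p1hat L q0 q1 q2) = 0) (q0 q1 q2 u : Vec n) :
    fderiv ℝ (fderiv ℝ L) (q0, q1, q2) (0, 0, u) (0, 0, gammaOf L φ q0 q1 q2) = 0 := by
  simpa [← Prod.zero_eq_mk] using fderiv_constraint hL hφ hφ0 q0 q1 q2 0 0 u

lemma hessOp_gammaOf (hL : ContDiff ℝ (⊤ : ℕ∞) L) (hφ : ContDiff ℝ (⊤ : ℕ∞) φ)
    (hφ0 : ∀ q0 q1 q2 : Vec n, φ (q0, q1, p1hat L q0 q1 q2) = 0) (q0 q1 q2 : Vec n) :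
    hessOp L q0 q1 q2 (gammaOf L φ q0 q1 q2) = 0 := by
  ext a
  have hι : HasFDerivAt (fun y : Vec n => (q0, q1, y))
      (ContinuousLinearMap.inr ℝ (Vec n) (Vec n × Vec n) ∘L .inr ℝ (Vec n) (Vec n)) q2 :=
    HasFDerivAt.comp q2 (hasFDerivAt_prodMk_right (𝕜 := ℝ) q0 (q1, q2))
      (hasFDerivAt_prodMk_right (𝕜 := ℝ) q1 q2)
  have h := (hasFDerivAt_fderiv_apply hL (q0, q1, q2) (0, 0, Pi.single a 1)).comp q2 hι
  refine (congrArg (· (gammaOf L φ q0 q1 q2)) h.fderiv).trans ?_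
  simpa [fderiv_fderiv_symm hL _ (0, 0, gammaOf L φ q0 q1 q2)] using
    hess_gammaOf hL hφ hφ0 q0 q1 q2 (Pi.single a 1)

lemma differentiable_gammaOf (hL : ContDiff ℝ (⊤ : ℕ∞) L) (hφ : ContDiff ℝ (⊤ : ℕ∞) φ) :
    Differentiable ℝ fun y : Vec n × Vec n × Vec n => gammaOf L φ y.1 y.2.1 y.2.2 := by
  have hP : Differentiable ℝ fun y : Vec n × Vec n × Vec n => p1hat L y.1 y.2.1 y.2.2 :=
    fun x => (hasFDerivAt_p1hat_s10 hL x).differentiableAt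
  have hQ : Differentiable ℝ fun y : Vec n × Vec n × Vec n =>
      (y.1, y.2.1, p1hat L y.1 y.2.1 y.2.2) := by fun_prop
  refine differentiable_pi.2 fun a => ?_
  have hd : Differentiable ℝ fun z => fderiv ℝ φ z (0, 0, Pi.single a 1) :=
    fun z => (hasFDerivAt_fderiv_apply hφ z _).differentiableAt
  exact hd.comp hQ

lemma third_derivative_gammaOf (hL : ContDiff ℝ (⊤ : ℕ∞) L) (hφ : ContDiff ℝ (⊤ : ℕ∞) φ)
    (hχ : ContDiff ℝ (⊤ : ℕ∞) χ)
    (hφ0 : ∀ q0 q1 q2 : Vec n, φ (q0, q1, p1hat L q0 q1 q2) = 0)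
    (hχ0 : ∀ q0 q1 q2 : Vec n, χ (q0, q1, p1hat L q0 q1 q2) = 0)
    (q0 q1 q2 : Vec n) (ξ : Vec n × Vec n × Vec n) :
    fderiv ℝ (fderiv ℝ (fderiv ℝ L)) (q0, q1, q2) ξ (0, 0, gammaOf L χ q0 q1 q2)
      (0, 0, gammaOf L φ q0 q1 q2) = 0 := by
  set w := gammaOf L χ q0 q1 q2
  have hγ := (differentiable_gammaOf hL hφ (q0, q1, q2)).hasFDerivAt
  have hι := (ContinuousLinearMap.inr ℝ (Vec n) (Vec n × Vec n) ∘L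
    ContinuousLinearMap.inr ℝ (Vec n) (Vec n)).hasFDerivAt.comp (q0, q1, q2) hγ
  have h := ((hasFDerivAt_fderiv_fderiv hL (q0, q1, q2)).clm_apply
    (hasFDerivAt_const (0, 0, w) (q0, q1, q2))).clm_apply hι
  have hz := h.congr_of_eventuallyEq (f₁ := fun _ => 0) <| .of_forall fun y => by
    simpa using (hess_gammaOf hL hφ hφ0 y.1 y.2.1 y.2.2 w).symm
  have he := congrArg (· ξ) (hz.unique (hasFDerivAt_const 0 _))
  have hk : ∀ u : Vec n, fderiv ℝ (fderiv ℝ L) (q0, q1, q2) (0, 0, w) (0, 0, u) = 0 := fun u => by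
    rw [fderiv_fderiv_symm hL]
    exact hess_gammaOf hL hχ hχ0 q0 q1 q2 u
  simpa [hk] using he

lemma fderiv_dot_EL (hL : ContDiff ℝ (⊤ : ℕ∞) L) (q0 q1 q2 q3 q4 v w : Vec n) :
    fderiv ℝ (fun q3' => dot (EL L q0 q1 q2 q3' q4) v) q3 w =
      - fderiv ℝ (fderiv ℝ L) (q0, q1, q2) (0, 0, w) (0, v, 0)
      + 2 * fderiv ℝ (fderiv ℝ (fderiv ℝ L)) (q0, q1, q2) (q1, q2, q3) (0, 0, w) (0, 0, v)
      + fderiv ℝ (fderiv ℝ L) (q0, q1, q2) (0, w, 0) (0, 0, v) := by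
  have h := fderiv_quadratic_comp_affine (fderiv ℝ L (q0, q1, q2) (v, 0, 0))
    ((fderiv ℝ (fderiv ℝ L) (q0, q1, q2)).flip (0, v, 0))
    ((fderiv ℝ (fderiv ℝ L) (q0, q1, q2)).flip (0, 0, v))
    (fderiv ℝ (fderiv ℝ (fderiv ℝ L)) (q0, q1, q2)) (0, 0, v) (q1, q2, 0) (q2, 0, q4)
    (.inr ℝ (Vec n) (Vec n × Vec n) ∘L .inr ℝ (Vec n) (Vec n))
    (.inr ℝ (Vec n) (Vec n × Vec n) ∘L .inl ℝ (Vec n) (Vec n)) q3 w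
  rw [fderiv_fderiv_fderiv_symm hL] at h
  simp only [dot_EL hL]
  simpa [two_mul] using h

lemma PB_lift (hφ : ContDiff ℝ (⊤ : ℕ∞) φ) (hχ : ContDiff ℝ (⊤ : ℕ∞) χ) (q0 q1 q2 p0 : Vec n) :
    PB (fun z => φ (z.1, z.2.1, z.2.2.2)) (fun z => χ (z.1, z.2.1, z.2.2.2))
        (q0, q1, p0, p1hat L q0 q1 q2) =
      fderiv ℝ φ (q0, q1, p1hat L q0 q1 q2) (0, gammaOf L χ q0 q1 q2, 0) -
      fderiv ℝ χ (q0, q1, p1hat L q0 q1 q2) (0, gammaOf L φ q0 q1 q2, 0) := by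
  let π : Vec n × Vec n × Vec n × Vec n →L[ℝ] Vec n × Vec n × Vec n :=
    (ContinuousLinearMap.fst ℝ _ _).prod
      ((ContinuousLinearMap.fst ℝ _ _ ∘L .snd ℝ _ _).prod
        (ContinuousLinearMap.snd ℝ _ _ ∘L .snd ℝ _ _ ∘L .snd ℝ _ _))
  have hd : ∀ ψ : Vec n × Vec n × Vec n → ℝ, ContDiff ℝ (⊤ : ℕ∞) ψ →
      fderiv ℝ (fun z : Vec n × Vec n × Vec n × Vec n => ψ (z.1, z.2.1, z.2.2.2))
        (q0, q1, p0, p1hat L q0 q1 q2) = (fderiv ℝ ψ (q0, q1, p1hat L q0 q1 q2)) ∘L π :=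
    fun ψ hψ => ((hψ.differentiable (by simp) (π (q0, q1, p0, p1hat L q0 q1 q2))).hasFDerivAt.comp
      _ π.hasFDerivAt).fderiv
  rw [← dot_clm_snd, ← dot_clm_snd, PB, hd φ hφ, hd χ hχ]
  simp only [π, dot, gammaOf, ContinuousLinearMap.comp_apply, ContinuousLinearMap.prod_apply,
    ContinuousLinearMap.coe_fst', ContinuousLinearMap.coe_snd', Prod.mk_zero_zero, map_zero,
    zero_mul, mul_zero, Finset.sum_const_zero, sub_zero, zero_add, sub_right_inj]
  exact Finset.sum_congr rfl fun a _ => mul_comm _ _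

end KernelFields

/-- Let `φ, χ` be primary Hamiltonian constraints of a
second-order Lagrangian (independent of `p⁰`, vanishing on the image of the
Legendre–Ostrogradskii map), and `γ_φ, γ_χ` the associated kernel vector
fields.  Then (i) `Wγ_φ = 0` and `Wγ_χ = 0`; (ii) `⟨[L],γ_φ⟩` does not depend
on `q₄`; (iii) the directional derivative of `⟨[L],γ_φ⟩` with respect to `q₃`
in the direction `γ_χ` equals `−{φ,χ}∘FL` (lifting `φ, χ` to phase-space
functions independent of `p⁰`). -/
theorem primary_constraint_kernel_fields
    (n : ℕ) (hn : 1 ≤ n)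
    (L : Vec n × Vec n × Vec n → ℝ) (hL : ContDiff ℝ (⊤ : ℕ∞) L)
    (φ χ : Vec n × Vec n × Vec n → ℝ)
    (hφ : ContDiff ℝ (⊤ : ℕ∞) φ) (hχ : ContDiff ℝ (⊤ : ℕ∞) χ)
    (hφ0 : ∀ q0 q1 q2 : Vec n, φ (q0, q1, p1hat L q0 q1 q2) = 0)
    (hχ0 : ∀ q0 q1 q2 : Vec n, χ (q0, q1, p1hat L q0 q1 q2) = 0) :
    (∀ q0 q1 q2 : Vec n,
        hessOp L q0 q1 q2 (gammaOf L φ q0 q1 q2) = 0 ∧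
        hessOp L q0 q1 q2 (gammaOf L χ q0 q1 q2) = 0) ∧
    (∀ q0 q1 q2 q3 q4 q4' : Vec n,
        dot (EL L q0 q1 q2 q3 q4) (gammaOf L φ q0 q1 q2) =
          dot (EL L q0 q1 q2 q3 q4') (gammaOf L φ q0 q1 q2)) ∧
    (∀ q0 q1 q2 q3 q4 : Vec n,
        fderiv ℝ (fun q3' => dot (EL L q0 q1 q2 q3' q4) (gammaOf L φ q0 q1 q2))
            q3 (gammaOf L χ q0 q1 q2) =
          - PB (fun z => φ (z.1, z.2.1, z.2.2.2))
               (fun z => χ (z.1, z.2.1, z.2.2.2))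
               (q0, q1, p0hat L q0 q1 q2 q3, p1hat L q0 q1 q2)) := by
  refine ⟨fun q0 q1 q2 => ⟨hessOp_gammaOf hL hφ hφ0 q0 q1 q2, hessOp_gammaOf hL hχ hχ0 q0 q1 q2⟩,
    fun q0 q1 q2 q3 q4 q4' => ?_, fun q0 q1 q2 q3 q4 => ?_⟩
  · have h := hess_gammaOf hL hφ hφ0 q0 q1 q2 (q4 - q4')
    have hs : ((0, 0, q4 - q4') : Vec n × Vec n × Vec n) = (q2, q3, q4) - (q2, q3, q4') := by simp
    rw [hs, map_sub, sub_apply, sub_eq_zero] at h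
    rw [dot_EL hL, dot_EL hL, h]
  · have h1 := fderiv_constraint hL hφ hφ0 q0 q1 q2 0 (gammaOf L χ q0 q1 q2) 0
    have h2 := fderiv_constraint hL hχ hχ0 q0 q1 q2 0 (gammaOf L φ q0 q1 q2) 0
    rw [fderiv_dot_EL hL, PB_lift hφ hχ, third_derivative_gammaOf hL hφ hχ hφ0 hχ0,
      fderiv_fderiv_symm hL _ (0, 0, gammaOf L χ q0 q1 q2)]
    linarith

end
end
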